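/- Let τ₁, τ₂, τ₃ > 0 be pairwise distinct, let k_i = 1/(τ₁τ₂τ₃), k_p = (τ₁+τ₂+τ₃)/(τ₁τ₂τ₃), k_d = (τ₁τ₂+τ₁τ₃+τ₂τ₃)/(τ₁τ₂τ₃), and let A_cl = [[0,1,0],[0,0,1],[−k_i,−k_p,−k_d]]. Then every differentiable solution X : ℝ → ℝ³ of the linear ODE X'(t) = A_cl · X(t) converges to 0 as t → ∞; i.e., the pole-placed closed loop is asymptotically stable and the tracking error converges to steady state. -/

import Mathlib

open Filter Topology

/-- Solutions of `f' = -a f` with `a > 0` decay to `0`. -/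
theorem tendsto_zero_of_hasDerivAt_neg_mul {a : ℝ} (ha : 0 < a) {f : ℝ → ℝ}
    (hf : ∀ t, HasDerivAt f (-a * f t) t) : Tendsto f atTop (𝓝 0) := by
  have hderiv : ∀ t, HasDerivAt (fun s => f s * Real.exp (a * s)) 0 t := fun t => by
    have hlin : HasDerivAt (fun s : ℝ => a * s) a t := by
      simpa using (hasDerivAt_id t).const_mul a
    exact ((hf t).mul hlin.exp).congr_deriv (by ring)
  have hconst : ∀ t, f t * Real.exp (a * t) = f 0 := fun t => by
    simpa using is_const_of_deriv_eq_zero (fun s => (hderiv s).differentiableAt)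
      (fun s => (hderiv s).deriv) t 0
  have hsol : f = fun t => f 0 * Real.exp (-(a * t)) := by
    funext t
    rw [← hconst t, mul_assoc, ← Real.exp_add, add_neg_cancel, Real.exp_zero, mul_one]
  rw [hsol]
  simpa using (Real.tendsto_exp_neg_atTop_nhds_zero.comp
    (tendsto_id.const_mul_atTop ha)).const_mul (f 0)

/-- The left eigenvector of the companion matrix with eigenvalues `-a`, `-b`, `-c` belonging to
`-a` yields a decaying combination of the state components. -/
theorem tendsto_zero_companion_mode {a b c : ℝ} (ha : 0 < a) {x y z : ℝ → ℝ}
    (hx : ∀ t, HasDerivAt x (y t) t) (hy : ∀ t, HasDerivAt y (z t) t)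
    (hz : ∀ t, HasDerivAt z
      (-(a * b * c) * x t - (a * b + a * c + b * c) * y t - (a + b + c) * z t) t) :
    Tendsto (fun t => b * c * x t + (b + c) * y t + z t) atTop (𝓝 0) :=
  tendsto_zero_of_hasDerivAt_neg_mul ha fun t =>
    ((((hx t).const_mul (b * c)).add ((hy t).const_mul (b + c))).add (hz t)).congr_deriv (by ring)

/-- A third-order linear system in companion form with distinct negative real poles decays. -/
theorem tendsto_zero_companion {a b c : ℝ} (ha : 0 < a) (hb : 0 < b) (hc : 0 < c)
    (hab : a ≠ b) (hac : a ≠ c) (hbc : b ≠ c) {x y z : ℝ → ℝ}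
    (hx : ∀ t, HasDerivAt x (y t) t) (hy : ∀ t, HasDerivAt y (z t) t)
    (hz : ∀ t, HasDerivAt z
      (-(a * b * c) * x t - (a * b + a * c + b * c) * y t - (a + b + c) * z t) t) :
    Tendsto x atTop (𝓝 0) ∧ Tendsto y atTop (𝓝 0) ∧ Tendsto z atTop (𝓝 0) := by
  have hwa := tendsto_zero_companion_mode ha hx hy hz
  have hwb := tendsto_zero_companion_mode (b := a) (c := c) hb hx hy
    fun t => (hz t).congr_deriv (by ring)
  have hwc := tendsto_zero_companion_mode (b := a) (c := b) hc hx hy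
    fun t => (hz t).congr_deriv (by ring)
  have hba : b - a ≠ 0 := sub_ne_zero.mpr hab.symm
  have hca : c - a ≠ 0 := sub_ne_zero.mpr hac.symm
  have hcb : c - b ≠ 0 := sub_ne_zero.mpr hbc.symm
  have hyc : Tendsto (fun t => c * x t + y t) atTop (𝓝 0) := by
    have h := (hwa.sub hwb).div_const (b - a)
    rw [sub_zero, zero_div] at h
    refine h.congr fun t => ?_
    field_simp
    ring
  have hyb : Tendsto (fun t => b * x t + y t) atTop (𝓝 0) := by
    have h := (hwa.sub hwc).div_const (c - a)
    rw [sub_zero, zero_div] at h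
    refine h.congr fun t => ?_
    field_simp
    ring
  have hx0 : Tendsto x atTop (𝓝 0) := by
    have h := (hyc.sub hyb).div_const (c - b)
    rw [sub_zero, zero_div] at h
    refine h.congr fun t => ?_
    field_simp
    ring
  have hy0 : Tendsto y atTop (𝓝 0) := by
    simpa using hyc.sub (hx0.const_mul c)
  have hz0 : Tendsto z atTop (𝓝 0) := by
    simpa using hwa.sub ((hx0.const_mul (b * c)).add (hy0.const_mul (b + c)))
  exact ⟨hx0, hy0, hz0⟩

/-- Asymptotic stability of the pole-placed closed loop: for pairwise distinct
`τ₁, τ₂, τ₃ > 0` and the corresponding pole-placement gains, every differentiable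
solution `X : ℝ → ℝ³` of `X' = A_cl X` converges to `0` as `t → ∞`. -/
theorem closed_loop_asymptotic_stability
    (τ₁ τ₂ τ₃ : ℝ) (h₁ : 0 < τ₁) (h₂ : 0 < τ₂) (h₃ : 0 < τ₃)
    (h₁₂ : τ₁ ≠ τ₂) (h₁₃ : τ₁ ≠ τ₃) (h₂₃ : τ₂ ≠ τ₃)
    (ki kp kd : ℝ)
    (hki : ki = 1 / (τ₁ * τ₂ * τ₃))
    (hkp : kp = (τ₁ + τ₂ + τ₃) / (τ₁ * τ₂ * τ₃))
    (hkd : kd = (τ₁ * τ₂ + τ₁ * τ₃ + τ₂ * τ₃) / (τ₁ * τ₂ * τ₃))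
    (Acl : Matrix (Fin 3) (Fin 3) ℝ)
    (hA : Acl = !![(0 : ℝ), 1, 0;
                   0, 0, 1;
                   -ki, -kp, -kd])
    (X : ℝ → (Fin 3 → ℝ))
    (hX : ∀ t : ℝ, HasDerivAt X (Acl.mulVec (X t)) t) :
    Filter.Tendsto X Filter.atTop (nhds 0) := by
  have hcomp : ∀ t i, HasDerivAt (fun s => X s i) (Acl.mulVec (X t) i) t :=
    fun t => hasDerivAt_pi.mp (hX t)
  obtain ⟨hx, hy, hz⟩ := tendsto_zero_companion (a := τ₁⁻¹) (b := τ₂⁻¹) (c := τ₃⁻¹)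
    (x := fun t => X t 0) (y := fun t => X t 1) (z := fun t => X t 2)
    (inv_pos.mpr h₁) (inv_pos.mpr h₂) (inv_pos.mpr h₃)
    (inv_injective.ne h₁₂) (inv_injective.ne h₁₃) (inv_injective.ne h₂₃)
    (fun t => (hcomp t 0).congr_deriv (by simp [hA, Matrix.mulVec, dotProduct, Fin.sum_univ_three]))
    (fun t => (hcomp t 1).congr_deriv (by simp [hA, Matrix.mulVec, dotProduct, Fin.sum_univ_three]))
    (fun t => (hcomp t 2).congr_deriv (by
      simp only [hA, hki, hkp, hkd, Matrix.mulVec, dotProduct, Fin.sum_univ_three, Matrix.of_apply,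
        Matrix.cons_val]
      field_simp
      ring))
  rw [tendsto_pi_nhds]
  intro i
  fin_cases i
  exacts [hx, hy, hz]
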